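/- Let 0 < d < 1/2 and x, x' > 0. Then lim_{n→∞} n^{-1-2d} ∫_{-π}^{π} D_{⌊nx⌋}(u) · conj(D_{⌊nx'⌋}(u)) · |u|^{-2d} du = (κ²(d)/2) · (x^{2d+1} + x'^{2d+1} - |x - x'|^{2d+1}), where κ²(d) = ∫_ℝ |1 - e^{iv}|² |v|^{-2-2d} dv. -/

import Mathlib

open Real Complex MeasureTheory

noncomputable def Dker (n : ℕ) (u : ℝ) : ℂ :=
  ∑ t ∈ Finset.range n, Complex.exp (Complex.I * (t + 1) * u)

lemma integrable_inv_one_add_sq_mul_abs_rpow {r : ℝ} (hr : -1 < r) (hr0 : r ≤ 0) :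
    Integrable fun v : ℝ => (1 + v ^ 2)⁻¹ * |v| ^ r := by
  have h01 : IntervalIntegrable (fun v : ℝ => |v| ^ r) volume 0 1 := by
    refine (intervalIntegral.intervalIntegrable_rpow' hr (a := 0) (b := 1)).congr ?_
    intro v hv
    rw [Set.uIoc_of_le zero_le_one] at hv
    simp only [abs_of_pos hv.1]
  have h10 : IntervalIntegrable (fun v : ℝ => |v| ^ r) volume (-1) 0 := by
    have := ((IntervalIntegrable.iff_comp_neg).mp h01).symm
    simpa using this
  have hI : IntegrableOn (fun v : ℝ => |v| ^ r) (Set.Ioc (-1) 1) :=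
    (intervalIntegrable_iff_integrableOn_Ioc_of_le (by norm_num)).mp (h10.trans h01)
  refine ((hI.integrable_indicator measurableSet_Ioc).add integrable_inv_one_add_sq).mono'
    (by fun_prop) (.of_forall fun v => ?_)
  have h0 : 0 ≤ |v| ^ r := by positivity
  have h1 : (1 + v ^ 2)⁻¹ ≤ 1 := inv_le_one_of_one_le₀ (by nlinarith [sq_nonneg v])
  have h2 : 0 ≤ (1 + v ^ 2)⁻¹ := by positivity
  rw [Real.norm_of_nonneg (by positivity)]
  by_cases hv : v ∈ Set.Ioc (-1 : ℝ) 1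
  · simp only [Pi.add_apply, Set.indicator_of_mem hv]
    nlinarith
  · simp only [Pi.add_apply, Set.indicator_of_notMem hv, zero_add]
    have hv1 : 1 ≤ |v| := by
      by_contra! h
      exact hv ⟨(abs_lt.mp h).1, (abs_lt.mp h).2.le⟩
    exact mul_le_of_le_one_right h2 (Real.rpow_le_one_of_one_le_of_nonpos hv1 hr0)

lemma mul_le_inv_one_add_sq {a b A B P v : ℝ} (ha : 0 ≤ a) (hb : 0 ≤ b) (haA : a ≤ A)
    (hbB : b ≤ B) (haP : |v| * a ≤ P) (hbP : |v| * b ≤ P) :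
    a * b ≤ (A * B + P ^ 2) * (1 + v ^ 2)⁻¹ := by
  rw [← div_eq_mul_inv, le_div_iff₀ (by positivity)]
  have h1 : a * b ≤ A * B := mul_le_mul haA hbB hb (ha.trans haA)
  have h2 : (|v| * a) * (|v| * b) ≤ P * P :=
    mul_le_mul haP hbP (by positivity) ((by positivity : 0 ≤ |v| * a).trans haP)
  have h3 : (|v| * a) * (|v| * b) = a * b * v ^ 2 := by rw [← sq_abs v]; ring
  linarith

lemma Dker_mul_sub_one (m : ℕ) (u : ℝ) :
    Dker m u * (cexp (I * u) - 1) = cexp (I * u) * (cexp (I * (m * u : ℝ)) - 1) := by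
  have h : Dker m u = cexp (I * u) * ∑ t ∈ Finset.range m, cexp (I * u) ^ t := by
    rw [Dker, Finset.mul_sum]
    refine Finset.sum_congr rfl fun t _ => ?_
    rw [← Complex.exp_nat_mul, ← Complex.exp_add]
    ring_nf
  rw [h, mul_assoc, geom_sum_mul, ← Complex.exp_nat_mul]
  push_cast
  ring_nf

lemma norm_Dker_le (m : ℕ) (u : ℝ) : ‖Dker m u‖ ≤ m := by
  refine (norm_sum_le _ _).trans ?_
  have h (t : ℕ) : ‖cexp (I * (t + 1) * u)‖ = 1 := by
    have : I * (t + 1) * u = ((t + 1) * u : ℝ) * I := by push_cast; ring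
    rw [this, Complex.norm_exp_ofReal_mul_I]
  simp [h]

lemma norm_exp_I_mul_ofReal_sub_one_le_two (y : ℝ) : ‖cexp (I * y) - 1‖ ≤ 2 := by
  rw [Complex.norm_exp_I_mul_ofReal_sub_one, norm_mul]
  have := Real.abs_sin_le_one (y / 2)
  simp only [Real.norm_eq_abs, abs_two]
  linarith

lemma abs_mul_norm_Dker_le (m : ℕ) {u : ℝ} (hu : |u| ≤ π) : |u| * ‖Dker m u‖ ≤ π := by
  have h1 : ‖Dker m u‖ * ‖cexp (I * u) - 1‖ ≤ 2 := by
    rw [← norm_mul, Dker_mul_sub_one, norm_mul, mul_comm I (u : ℂ),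
      Complex.norm_exp_ofReal_mul_I, one_mul]
    exact norm_exp_I_mul_ofReal_sub_one_le_two _
  have h2 : 2 / π * |u| ≤ ‖cexp (I * u) - 1‖ := by
    have hs := Real.mul_abs_le_abs_sin (x := u / 2) (by
      rw [abs_div, abs_two]; linarith)
    rw [Complex.norm_exp_I_mul_ofReal_sub_one, norm_mul]
    simp only [Real.norm_eq_abs, abs_two]
    rw [abs_div, abs_two] at hs
    linarith
  have h3 : ‖Dker m u‖ * (2 / π * |u|) ≤ 2 :=
    (mul_le_mul_of_nonneg_left h2 (norm_nonneg _)).trans h1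
  have hpi := Real.pi_pos
  have h4 : ‖Dker m u‖ * (2 / π * |u|) = 2 / π * (|u| * ‖Dker m u‖) := by ring
  rw [h4, div_mul_eq_mul_div, div_le_iff₀ hpi] at h3
  linarith

/-- The Dirichlet kernel of length `⌊n y⌋` rescaled to frequency `v / n`. -/
noncomputable def scaledDker (n : ℕ) (y v : ℝ) : ℂ := Dker ⌊(n : ℝ) * y⌋₊ (v / n) / n

/-- The Fourier transform of the indicator of `[0, y]`, away from `v = 0`. -/
noncomputable def intervalFourier (y v : ℝ) : ℂ := (cexp (I * (y * v : ℝ)) - 1) / (I * v)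

lemma measurable_scaledDker (n : ℕ) (y : ℝ) : Measurable (scaledDker n y) := by
  unfold scaledDker Dker
  fun_prop

lemma norm_scaledDker_le {n : ℕ} (hn : 0 < n) {y : ℝ} (hy : 0 ≤ y) (v : ℝ) :
    ‖scaledDker n y v‖ ≤ y := by
  have hn' : (0 : ℝ) < n := by exact_mod_cast hn
  rw [scaledDker, norm_div, Complex.norm_natCast, div_le_iff₀ hn']
  refine (norm_Dker_le _ _).trans ((Nat.floor_le (by positivity)).trans_eq (mul_comm _ _))

lemma abs_mul_norm_scaledDker_le {n : ℕ} (hn : 0 < n) (y : ℝ) {v : ℝ} (hv : |v| ≤ n * π) :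
    |v| * ‖scaledDker n y v‖ ≤ π := by
  have hn' : (0 : ℝ) < n := by exact_mod_cast hn
  have hu : |v / n| ≤ π := by
    rw [abs_div, Nat.abs_cast, div_le_iff₀ hn']; linarith
  have := abs_mul_norm_Dker_le ⌊(n : ℝ) * y⌋₊ hu
  rw [abs_div, Nat.abs_cast] at this
  rw [scaledDker, norm_div, Complex.norm_natCast]
  calc _ = _ := by ring
    _ ≤ π := this

lemma tendsto_scaledDker {y : ℝ} (hy : 0 ≤ y) {v : ℝ} (hv : v ≠ 0) :
    Filter.Tendsto (fun n : ℕ => scaledDker n y v) Filter.atTop (nhds (intervalFourier y v)) := by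
  have hvn : Filter.Tendsto (fun n : ℕ => v / (n : ℝ)) Filter.atTop (nhds 0) :=
    tendsto_const_div_atTop_nhds_zero_nat v
  have hfloor : Filter.Tendsto (fun n : ℕ => (⌊(n : ℝ) * y⌋₊ : ℝ) / n) Filter.atTop (nhds y) := by
    have := (tendsto_nat_floor_mul_div_atTop hy).comp tendsto_natCast_atTop_atTop
    simpa [Function.comp_def, mul_comm] using this
  have hslope : Filter.Tendsto (fun n : ℕ => (n : ℂ) * (cexp (I * (v / n : ℝ)) - 1))
      Filter.atTop (nhds (I * v)) := by
    have hd : HasDerivAt (fun t : ℝ => cexp (I * (t * v : ℝ))) (I * v) 0 := by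
      have h1 : HasDerivAt (fun t : ℝ => I * ((t * v : ℝ) : ℂ)) (I * v) 0 := by
        have := (((hasDerivAt_id (0 : ℝ)).mul_const v).ofReal_comp).const_mul I
        simpa using this
      simpa using h1.cexp
    have hinv : Filter.Tendsto (fun n : ℕ => ((n : ℝ))⁻¹) Filter.atTop
        (nhdsWithin 0 {0}ᶜ) := by
      refine tendsto_nhdsWithin_iff.mpr ⟨tendsto_inv_atTop_nhds_zero_nat, ?_⟩
      filter_upwards [Filter.eventually_gt_atTop 0] with n hn
      simpa using hn.ne'
    refine (hd.tendsto_slope_zero.comp hinv).congr fun n => ?_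
    simp [div_eq_mul_inv, mul_comm]
  have hcont (w : ℝ) : Continuous fun t : ℝ => cexp (I * (t * w : ℝ)) := by fun_prop
  have hone : Filter.Tendsto (fun n : ℕ => cexp (I * (v / n : ℝ))) Filter.atTop (nhds 1) := by
    have := ((hcont 1).tendsto 0).comp hvn
    simpa [Function.comp_def] using this
  have hnum : Filter.Tendsto (fun n : ℕ => cexp (I * (⌊(n : ℝ) * y⌋₊ / n * v : ℝ)))
      Filter.atTop (nhds (cexp (I * (y * v : ℝ)))) := ((hcont v).tendsto y).comp hfloor
  have hIv : I * (v : ℂ) ≠ 0 := mul_ne_zero I_ne_zero (by exact_mod_cast hv)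
  have hlim := (hone.mul (hnum.sub_const 1)).div hslope hIv
  rw [one_mul] at hlim
  refine hlim.congr' ?_
  filter_upwards [hslope.eventually_ne hIv, Filter.eventually_gt_atTop 0] with n hne hn
  have hn' : (n : ℂ) ≠ 0 := by exact_mod_cast hn.ne'
  have key := Dker_mul_sub_one ⌊(n : ℝ) * y⌋₊ (v / n)
  have harg : (⌊(n : ℝ) * y⌋₊ : ℝ) * (v / n) = ⌊(n : ℝ) * y⌋₊ / n * v := by ring
  rw [harg] at key
  simp only [Pi.div_apply]
  rw [scaledDker, ← key, div_eq_div_iff hne hn']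
  ring

lemma norm_intervalFourier_le {y : ℝ} (hy : 0 ≤ y) (v : ℝ) : ‖intervalFourier y v‖ ≤ y := by
  rcases eq_or_ne v 0 with rfl | hv
  · simpa [intervalFourier] using hy
  rw [intervalFourier, norm_div, norm_mul, norm_I, one_mul, norm_real,
    div_le_iff₀ (norm_pos_iff.mpr hv)]
  have := Real.norm_exp_I_mul_ofReal_sub_one_le (x := y * v)
  rwa [norm_mul, Real.norm_of_nonneg hy] at this

lemma abs_mul_norm_intervalFourier_le (y v : ℝ) : |v| * ‖intervalFourier y v‖ ≤ 2 := by
  rcases eq_or_ne v 0 with rfl | hv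
  · simp
  rw [intervalFourier, norm_div, norm_mul, norm_I, one_mul, norm_real, Real.norm_eq_abs,
    mul_div_cancel₀ _ (abs_ne_zero.mpr hv)]
  exact norm_exp_I_mul_ofReal_sub_one_le_two _

lemma measurable_intervalFourier (y : ℝ) : Measurable (intervalFourier y) := by
  unfold intervalFourier
  fun_prop

lemma norm_mul_conj_mul_le {z w : ℂ} {A B P v d : ℝ} (hz : ‖z‖ ≤ A) (hw : ‖w‖ ≤ B)
    (hzP : |v| * ‖z‖ ≤ P) (hwP : |v| * ‖w‖ ≤ P) :
    ‖z * (starRingEnd ℂ) w * (|v| ^ (-2 * d) : ℝ)‖ ≤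
      (A * B + P ^ 2) * ((1 + v ^ 2)⁻¹ * |v| ^ (-2 * d)) := by
  rw [norm_mul, norm_mul, RCLike.norm_conj, norm_real,
    Real.norm_of_nonneg (by positivity : 0 ≤ |v| ^ (-2 * d)), ← mul_assoc]
  exact mul_le_mul_of_nonneg_right
    (mul_le_inv_one_add_sq (norm_nonneg _) (norm_nonneg _) hz hw hzP hwP) (by positivity)

lemma integral_Dker_rescale {n : ℕ} (hn : 0 < n) (d x x' : ℝ) :
    (((n : ℝ) ^ (-1 - 2 * d) : ℝ) : ℂ) *
      ∫ u in (-π)..π, Dker ⌊(n : ℝ) * x⌋₊ u * (starRingEnd ℂ) (Dker ⌊(n : ℝ) * x'⌋₊ u) *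
        (|u| ^ (-2 * d) : ℝ) =
    ∫ v : ℝ, (Set.Ioc (-(n * π)) (n * π)).indicator (fun v =>
      scaledDker n x v * (starRingEnd ℂ) (scaledDker n x' v) * (|v| ^ (-2 * d) : ℝ)) v := by
  have hn' : (0 : ℝ) < n := by exact_mod_cast hn
  have hpi := Real.pi_pos
  rw [integral_indicator measurableSet_Ioc,
    ← intervalIntegral.integral_of_le (by nlinarith [mul_pos hn' hpi])]
  have hsub := intervalIntegral.integral_comp_div (a := -(n * π)) (b := n * π) (c := (n : ℝ))
    (fun u => Dker ⌊(n : ℝ) * x⌋₊ u * (starRingEnd ℂ) (Dker ⌊(n : ℝ) * x'⌋₊ u) *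
        (|u| ^ (-2 * d) : ℝ)) hn'.ne'
  rw [neg_div, mul_div_cancel_left₀ _ hn'.ne'] at hsub
  have hscal : (((n : ℝ) ^ (-1 - 2 * d) : ℝ) : ℂ) = (((n : ℝ) ^ (-2 - 2 * d) : ℝ) : ℂ) * n := by
    rw [← Complex.ofReal_natCast, ← Complex.ofReal_mul, ← Real.rpow_add_one hn'.ne']
    ring_nf
  rw [hscal, mul_assoc]
  rw [Complex.real_smul, Complex.ofReal_natCast] at hsub
  rw [← hsub, ← intervalIntegral.integral_const_mul]
  refine intervalIntegral.integral_congr fun v _ => ?_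
  have hpow : (n : ℝ) ^ (-2 - 2 * d) * |v / n| ^ (-2 * d) =
      (n : ℝ)⁻¹ * (n : ℝ)⁻¹ * |v| ^ (-2 * d) := by
    rw [abs_div, Nat.abs_cast, Real.div_rpow (abs_nonneg _) hn'.le,
      show -2 - 2 * d = -2 * d - 1 - 1 by ring, Real.rpow_sub_one hn'.ne',
      Real.rpow_sub_one hn'.ne']
    have : (n : ℝ) ^ (-2 * d) ≠ 0 := (Real.rpow_pos_of_pos hn' _).ne'
    field_simp
  have hpow' : (((n : ℝ) ^ (-2 - 2 * d) : ℝ) : ℂ) * ((|v / n| ^ (-2 * d) : ℝ) : ℂ) =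
      (n : ℂ)⁻¹ * (n : ℂ)⁻¹ * ((|v| ^ (-2 * d) : ℝ) : ℂ) := by
    rw [← Complex.ofReal_mul, hpow]
    push_cast
    rfl
  simp only [scaledDker, map_div₀, map_natCast]
  linear_combination Dker ⌊(n : ℝ) * x⌋₊ (v / n) *
    (starRingEnd ℂ) (Dker ⌊(n : ℝ) * x'⌋₊ (v / n)) * hpow'

lemma tendsto_integral_scaledDker {d x x' : ℝ} (hd0 : 0 < d) (hd1 : d < 1 / 2)
    (hx : 0 < x) (hx' : 0 < x') :
    Filter.Tendsto
      (fun n : ℕ => ∫ v : ℝ, (Set.Ioc (-(n * π)) (n * π)).indicator (fun v =>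
        scaledDker n x v * (starRingEnd ℂ) (scaledDker n x' v) * (|v| ^ (-2 * d) : ℝ)) v)
      Filter.atTop
      (nhds (∫ v : ℝ, intervalFourier x v * (starRingEnd ℂ) (intervalFourier x' v) *
        (|v| ^ (-2 * d) : ℝ))) := by
  refine tendsto_integral_filter_of_dominated_convergence
    (fun v => (x * x' + π ^ 2) * ((1 + v ^ 2)⁻¹ * |v| ^ (-2 * d))) ?_ ?_
    ((integrable_inv_one_add_sq_mul_abs_rpow (by linarith) (by linarith)).const_mul _) ?_
  · refine .of_forall fun n => ?_
    have h1 := measurable_scaledDker n x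
    have h2 := measurable_scaledDker n x'
    have h3 := Complex.continuous_conj.measurable.comp h2
    refine AEStronglyMeasurable.indicator (Measurable.aestronglyMeasurable ?_) measurableSet_Ioc
    exact (h1.mul h3).mul (by fun_prop)
  · filter_upwards [Filter.eventually_gt_atTop 0] with n hn
    refine .of_forall fun v => ?_
    by_cases hv : v ∈ Set.Ioc (-(n * π)) (n * π)
    · rw [Set.indicator_of_mem hv]
      have hv' : |v| ≤ n * π := abs_le.mpr ⟨hv.1.le, hv.2⟩
      exact norm_mul_conj_mul_le (norm_scaledDker_le hn hx.le v) (norm_scaledDker_le hn hx'.le v)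
        (abs_mul_norm_scaledDker_le hn x hv') (abs_mul_norm_scaledDker_le hn x' hv')
    · rw [Set.indicator_of_notMem hv, norm_zero]
      positivity
  · filter_upwards [compl_mem_ae_iff.mpr (measure_singleton (0 : ℝ))] with v hv
    have hlim := ((tendsto_scaledDker hx.le hv).mul
      ((Complex.continuous_conj.tendsto _).comp (tendsto_scaledDker hx'.le hv))).mul_const
        ((|v| ^ (-2 * d) : ℝ) : ℂ)
    refine hlim.congr' ?_
    have hN : Filter.Tendsto (fun n : ℕ => (n : ℝ) * π) Filter.atTop Filter.atTop :=
      tendsto_natCast_atTop_atTop.atTop_mul_const Real.pi_pos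
    filter_upwards [hN.eventually_gt_atTop |v|] with n hn
    have hmem : v ∈ Set.Ioc (-(n * π)) (n * π) := ⟨(abs_lt.mp hn).1, (abs_lt.mp hn).2.le⟩
    rw [Set.indicator_of_mem hmem]
    rfl

lemma abs_rpow_neg_two_sub {v : ℝ} (hv : v ≠ 0) (d : ℝ) :
    |v| ^ (-2 - 2 * d) = |v| ^ (-2 * d) / v ^ 2 := by
  rw [show -2 - 2 * d = -2 * d - 1 - 1 by ring, Real.rpow_sub_one (abs_ne_zero.mpr hv),
    Real.rpow_sub_one (abs_ne_zero.mpr hv), div_div, ← sq, sq_abs]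

lemma integrable_one_sub_cos_mul_abs_rpow {d : ℝ} (hd0 : 0 < d) (hd1 : d < 1 / 2) :
    Integrable fun v : ℝ => 2 * (1 - Real.cos v) * |v| ^ (-2 - 2 * d) := by
  refine ((integrable_inv_one_add_sq_mul_abs_rpow (r := -2 * d) (by linarith)
    (by linarith)).const_mul 5).mono' (by fun_prop) (.of_forall fun v => ?_)
  have hcos : 0 ≤ 1 - Real.cos v := by linarith [Real.cos_le_one v]
  rw [Real.norm_of_nonneg (by positivity)]
  rcases eq_or_ne v 0 with rfl | hv
  · simp only [Real.cos_zero, sub_self, mul_zero, zero_mul]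
    positivity
  have h1 : 2 * (1 - Real.cos v) ≤ v ^ 2 := by
    linarith [Real.one_sub_sq_div_two_le_cos (x := v)]
  have h2 : 2 * (1 - Real.cos v) ≤ 4 := by linarith [Real.neg_one_le_cos v]
  have hv2 : 0 < v ^ 2 := by positivity
  have h3 : 2 * (1 - Real.cos v) / v ^ 2 ≤ 5 * (1 + v ^ 2)⁻¹ := by
    rw [← div_eq_mul_inv, div_le_div_iff₀ hv2 (by positivity)]
    nlinarith
  rw [abs_rpow_neg_two_sub hv]
  calc _ = 2 * (1 - Real.cos v) / v ^ 2 * |v| ^ (-2 * d) := by ring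
    _ ≤ 5 * (1 + v ^ 2)⁻¹ * |v| ^ (-2 * d) := mul_le_mul_of_nonneg_right h3 (by positivity)
    _ = _ := by ring

lemma one_sub_cos_mul_eq_comp_mul {c : ℝ} (hc : c ≠ 0) (d v : ℝ) :
    2 * (1 - Real.cos (c * v)) * |v| ^ (-2 - 2 * d) =
      |c| ^ (2 + 2 * d) * (2 * (1 - Real.cos (c * v)) * |c * v| ^ (-2 - 2 * d)) := by
  have h : |c| ^ (2 + 2 * d) * |c| ^ (-2 - 2 * d) = 1 := by
    rw [← Real.rpow_add (abs_pos.mpr hc)]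
    ring_nf
    simp
  rw [abs_mul, Real.mul_rpow (abs_nonneg _) (abs_nonneg _)]
  linear_combination (-(2 * (1 - Real.cos (c * v)) * |v| ^ (-2 - 2 * d))) * h

lemma integrable_one_sub_cos_mul {d : ℝ} (hd0 : 0 < d) (hd1 : d < 1 / 2) (c : ℝ) :
    Integrable fun v : ℝ => 2 * (1 - Real.cos (c * v)) * |v| ^ (-2 - 2 * d) := by
  rcases eq_or_ne c 0 with rfl | hc
  · simp
  simp_rw [one_sub_cos_mul_eq_comp_mul hc]
  exact ((integrable_one_sub_cos_mul_abs_rpow hd0 hd1).comp_mul_left' hc).const_mul _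

lemma integral_one_sub_cos_mul {d : ℝ} (hd0 : 0 < d) (c : ℝ) :
    ∫ v : ℝ, 2 * (1 - Real.cos (c * v)) * |v| ^ (-2 - 2 * d) =
      |c| ^ (2 * d + 1) * ∫ v : ℝ, 2 * (1 - Real.cos v) * |v| ^ (-2 - 2 * d) := by
  rcases eq_or_ne c 0 with rfl | hc
  · simp [Real.zero_rpow (by positivity : 2 * d + 1 ≠ 0)]
  simp_rw [one_sub_cos_mul_eq_comp_mul hc]
  rw [integral_const_mul, Measure.integral_comp_mul_left
    (fun v => 2 * (1 - Real.cos v) * |v| ^ (-2 - 2 * d)) c, smul_eq_mul, ← mul_assoc,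
    abs_inv, ← Real.rpow_neg_one, ← Real.rpow_add (abs_pos.mpr hc)]
  ring_nf

lemma re_intervalFourier_mul_conj (d x x' v : ℝ) :
    (intervalFourier x v * (starRingEnd ℂ) (intervalFourier x' v) *
      (|v| ^ (-2 * d) : ℝ)).re =
    (2 * (1 - Real.cos (x * v)) * |v| ^ (-2 - 2 * d) +
      2 * (1 - Real.cos (x' * v)) * |v| ^ (-2 - 2 * d) -
      2 * (1 - Real.cos ((x - x') * v)) * |v| ^ (-2 - 2 * d)) / 2 := by
  rcases eq_or_ne v 0 with rfl | hv
  · simp [intervalFourier]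
  have hvC : (v : ℂ) ≠ 0 := by exact_mod_cast hv
  have hexp (y : ℝ) : cexp (I * (y * v : ℝ)) = Real.cos (y * v) + Real.sin (y * v) * I := by
    rw [mul_comm, Complex.exp_mul_I, ← Complex.ofReal_cos, ← Complex.ofReal_sin]
  have hprod : intervalFourier x v * (starRingEnd ℂ) (intervalFourier x' v) *
      (|v| ^ (-2 * d) : ℝ) =
      ((cexp (I * (x * v : ℝ)) - 1) * (starRingEnd ℂ) (cexp (I * (x' * v : ℝ)) - 1)) *
        ((|v| ^ (-2 - 2 * d) : ℝ) : ℂ) := by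
    rw [abs_rpow_neg_two_sub hv, intervalFourier, intervalFourier, map_div₀, map_mul, conj_I,
      conj_ofReal, Complex.ofReal_div, Complex.ofReal_pow]
    field_simp
    rw [I_sq]
    ring
  rw [hprod, Complex.re_mul_ofReal, hexp, hexp, sub_mul x x' v, Real.cos_sub]
  simp only [map_sub, map_add, map_mul, conj_ofReal, conj_I, map_one, mul_re, sub_re, add_re,
    ofReal_re, ofReal_im, I_re, I_im, sub_im, add_im, mul_im, neg_re, neg_im, one_re, one_im]
  ring

lemma conj_intervalFourier (y v : ℝ) :
    (starRingEnd ℂ) (intervalFourier y v) = intervalFourier y (-v) := by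
  simp [intervalFourier, ← Complex.exp_conj]

lemma integral_intervalFourier_mul_conj {d x x' : ℝ} (hd0 : 0 < d) (hd1 : d < 1 / 2)
    (hx : 0 < x) (hx' : 0 < x') :
    ∫ v : ℝ, intervalFourier x v * (starRingEnd ℂ) (intervalFourier x' v) *
        (|v| ^ (-2 * d) : ℝ) =
      ((((∫ v : ℝ, 2 * (1 - Real.cos v) * |v| ^ (-2 - 2 * d)) / 2) *
        (x ^ (2 * d + 1) + x' ^ (2 * d + 1) - |x - x'| ^ (2 * d + 1)) : ℝ) : ℂ) := by
  have hint : Integrable fun v : ℝ => intervalFourier x v *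
      (starRingEnd ℂ) (intervalFourier x' v) * (|v| ^ (-2 * d) : ℝ) := by
    refine ((integrable_inv_one_add_sq_mul_abs_rpow (r := -2 * d) (by linarith)
      (by linarith)).const_mul (x * x' + 2 ^ 2)).mono' ?_ (.of_forall fun v =>
        norm_mul_conj_mul_le (norm_intervalFourier_le hx.le v) (norm_intervalFourier_le hx'.le v)
          (abs_mul_norm_intervalFourier_le x v) (abs_mul_norm_intervalFourier_le x' v))
    exact (((measurable_intervalFourier x).mul (Complex.continuous_conj.measurable.comp
      (measurable_intervalFourier x'))).mul (by fun_prop)).aestronglyMeasurable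
  have hreal : (starRingEnd ℂ) (∫ v : ℝ, intervalFourier x v *
      (starRingEnd ℂ) (intervalFourier x' v) * (|v| ^ (-2 * d) : ℝ)) =
      ∫ v : ℝ, intervalFourier x v *
        (starRingEnd ℂ) (intervalFourier x' v) * (|v| ^ (-2 * d) : ℝ) := by
    rw [← integral_conj, ← integral_neg_eq_self]
    congr 1 with v
    simp only [map_mul, conj_intervalFourier, conj_ofReal, neg_neg, abs_neg]
  rw [← Complex.conj_eq_iff_re.mp hreal]
  congr 1
  have hre := integral_re hint
  simp only [RCLike.re_eq_complex_re] at hre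
  rw [← hre]
  simp_rw [re_intervalFourier_mul_conj]
  have hI := integrable_one_sub_cos_mul hd0 hd1
  have hadd : Integrable fun v : ℝ => 2 * (1 - Real.cos (x * v)) * |v| ^ (-2 - 2 * d) +
      2 * (1 - Real.cos (x' * v)) * |v| ^ (-2 - 2 * d) := (hI x).add (hI x')
  rw [integral_div, integral_sub hadd (hI (x - x')), integral_add (hI x) (hI x')]
  simp only [integral_one_sub_cos_mul hd0, abs_of_pos hx, abs_of_pos hx']
  ring

theorem stmt9 (d x x' : ℝ) (hd0 : 0 < d) (hd1 : d < 1 / 2)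
    (hx : 0 < x) (hx' : 0 < x') :
    Filter.Tendsto
      (fun n : ℕ =>
        (((n : ℝ) ^ (-1 - 2 * d) : ℝ) : ℂ) *
          ∫ u in (-π)..π,
            Dker ⌊(n : ℝ) * x⌋₊ u * (starRingEnd ℂ) (Dker ⌊(n : ℝ) * x'⌋₊ u) *
              (|u| ^ (-2 * d) : ℝ))
      Filter.atTop
      (nhds ((((∫ v : ℝ, 2 * (1 - Real.cos v) * |v| ^ (-2 - 2 * d)) / 2) *
        (x ^ (2 * d + 1) + x' ^ (2 * d + 1) - |x - x'| ^ (2 * d + 1)) : ℝ) : ℂ)) := by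
  rw [← integral_intervalFourier_mul_conj hd0 hd1 hx hx']
  refine (tendsto_integral_scaledDker hd0 hd1 hx hx').congr' ?_
  filter_upwards [Filter.eventually_gt_atTop 0] with n hn
  exact (integral_Dker_rescale hn d x x').symm
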